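/- arXiv:1907.05394 — 3 statements merged into one kernel-verified Lean document; each statement's English description precedes it below -/
import Mathlib

section
/- (1) If i : A → B is an anodyne map and j : C → D is a monomorphism of simplicial sets, then their pushout product (A × D) ⊔_{A × C} (B × C) → B × D is anodyne. (2) If i : A → B is a monomorphism and p : X → Y is a Kan fibration, then the pullback exponential X^B → X^A ×_{Y^A} Y^B is a Kan fibration; in particular, for every simplicial set A and every Kan complex K, the exponential K^A is a Kan complex. (3) If i : A → B is anodyne and p : X → Y is a Kan fibration, then the pullback exponential X^B → X^A ×_{Y^A} Y^B is a trivial fibration. -/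
open CategoryTheory CategoryTheory.Limits Simplicial MonoidalCategory SSet

noncomputable instance : MonoidalClosed SSet.{0} :=
  (inferInstance : MonoidalClosed (SimplexCategoryᵒᵖ ⥤ Type 0))

namespace Paper

/-- A map of simplicial sets is a *trivial fibration* if it has the right lifting
property with respect to all boundary inclusions `∂Δ[n] ⟶ Δ[n]` for `n ≥ 0`. -/
def TrivialFibration {X Y : SSet.{0}} (p : X ⟶ Y) : Prop :=
  ∀ n : ℕ, HasLiftingProperty (SSet.boundary n).ι p

/-- A map of simplicial sets is a *Kan fibration* if it has the right lifting property
with respect to all horn inclusions `Λ[n, i] ⟶ Δ[n]` for `n ≥ 1`, `0 ≤ i ≤ n`. -/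
def KanFibration {X Y : SSet.{0}} (p : X ⟶ Y) : Prop :=
  ∀ (n : ℕ) (i : Fin (n + 2)), HasLiftingProperty (SSet.horn (n + 1) i).ι p

/-- An *anodyne* map is one with the left lifting property with respect to
all Kan fibrations. -/
def Anodyne {A B : SSet.{0}} (i : A ⟶ B) : Prop :=
  ∀ ⦃X Y : SSet.{0}⦄ (p : X ⟶ Y), KanFibration p → HasLiftingProperty i p

/-- The unique map to `Δ[0]`. -/
def toPt (X : SSet.{0}) : X ⟶ Δ[0] where
  app m := ↾fun _ => SSet.stdSimplex.const 0 0 m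
  naturality := by
    intro m m' φ
    ext x
    apply stdSimplex.objEquiv.injective
    apply SimplexCategory.Hom.ext
    apply OrderHom.ext
    funext j
    exact @Subsingleton.elim (Fin 1) _ _ _

/-- A *Kan complex* is a simplicial set whose map to `Δ[0]` is a Kan fibration. -/
def KanComplex (X : SSet.{0}) : Prop :=
  KanFibration (toPt X)

/-- The constant map at the vertex `k` of `Δ[1]`. -/
def cst (X : SSet.{0}) (k : Fin 2) : X ⟶ Δ[1] where
  app m := ↾fun _ => SSet.stdSimplex.const 1 k m
  naturality := by
    intro m m' φ
    ext x
    apply stdSimplex.objEquiv.injective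
    apply SimplexCategory.Hom.ext
    ext j
    rfl

/-- The endpoint inclusion `X ⟶ X ⊗ Δ[1]` at the vertex `k` of `Δ[1]`. -/
noncomputable def ept (X : SSet.{0}) (k : Fin 2) : X ⟶ X ⊗ Δ[1] :=
  CartesianMonoidalCategory.lift (𝟙 X) (cst X k)

/-- A (single-step) homotopy from `f` to `g`, as a property of the pair `(f, g)`. -/
def Homotopy {X Y : SSet.{0}} (f g : X ⟶ Y) : Prop :=
  ∃ H : X ⊗ Δ[1] ⟶ Y, ept X 0 ≫ H = f ∧ ept X 1 ≫ H = g

/-- `f` and `g` are *homotopic* if they are connected by a zig-zag of homotopies. -/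
def Homotopic {X Y : SSet.{0}} (f g : X ⟶ Y) : Prop :=
  Relation.EqvGen Homotopy f g

/-- A *homotopy equivalence* of simplicial sets. -/
def HomotopyEquivalence {X Y : SSet.{0}} (f : X ⟶ Y) : Prop :=
  ∃ g : Y ⟶ X, Homotopic (f ≫ g) (𝟙 X) ∧ Homotopic (g ≫ f) (𝟙 Y)

/-- A map `f : X ⟶ Y` is a *weak homotopy equivalence* if for every Kan complex `K`
the induced map `K^Y ⟶ K^X` on exponentials is a homotopy equivalence. -/
def WeakHomotopyEquivalence {X Y : SSet.{0}} (f : X ⟶ Y) : Prop :=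
  ∀ K : SSet.{0}, KanComplex K → HomotopyEquivalence ((MonoidalClosed.pre f).app K)

/-- A homotopy `H` between maps over `B` which is *fiberwise over `B`*. -/
def FibHomotopy {B X Y : SSet.{0}} (pX : X ⟶ B) (pY : Y ⟶ B) (f g : X ⟶ Y) : Prop :=
  ∃ H : X ⊗ Δ[1] ⟶ Y, ept X 0 ≫ H = f ∧ ept X 1 ≫ H = g ∧
    H ≫ pY = CartesianMonoidalCategory.fst X Δ[1] ≫ pX

/-- Connectedness by a zig-zag of fiberwise homotopies over `B`. -/
def FibHomotopic {B X Y : SSet.{0}} (pX : X ⟶ B) (pY : Y ⟶ B) (f g : X ⟶ Y) : Prop :=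
  Relation.EqvGen (FibHomotopy pX pY) f g

/-- A *fiberwise homotopy equivalence over `B`*. -/
def FibHomotopyEquivalence {B X Y : SSet.{0}} (pX : X ⟶ B) (pY : Y ⟶ B) (f : X ⟶ Y) : Prop :=
  f ≫ pY = pX ∧ ∃ g : Y ⟶ X, g ≫ pX = pY ∧
    FibHomotopic pX pX (f ≫ g) (𝟙 X) ∧ FibHomotopic pY pY (g ≫ f) (𝟙 Y)

end Paper


namespace Paper

/-- The pushout product `(A ⊗ D) ⊔_{A ⊗ C} (B ⊗ C) ⟶ B ⊗ D` of `i : A ⟶ B` and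
`j : C ⟶ D`. -/
noncomputable def pushoutProd {A B C D : SSet.{0}} (i : A ⟶ B) (j : C ⟶ D) :
    pushout (A ◁ j) (i ▷ C) ⟶ B ⊗ D :=
  pushout.desc (i ▷ D) (B ◁ j) (whisker_exchange i j)

/-- The pullback exponential `X^B ⟶ X^A ×_{Y^A} Y^B` induced by `i : A ⟶ B` and
`p : X ⟶ Y`. -/
noncomputable def pullbackExp {A B X Y : SSet.{0}} (i : A ⟶ B) (p : X ⟶ Y) :
    (ihom B).obj X ⟶ pullback ((ihom A).map p) ((MonoidalClosed.pre i).app Y) :=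
  pullback.lift ((MonoidalClosed.pre i).app X) ((ihom B).map p)
    ((MonoidalClosed.pre i).naturality p).symm

end Paper

namespace Paper

open HomotopicalAlgebra SSet.modelCategoryQuillen

lemma kanFibration_iff {X Y : SSet.{0}} (p : X ⟶ Y) :
    KanFibration p ↔ fibrations SSet.{0} p := by
  rw [fibrations_eq]
  refine ⟨fun h _ _ _ hf ↦ ?_, fun h n i ↦ h _ (horn_ι_mem_J _ _)⟩
  simp only [J, MorphismProperty.iSup_iff] at hf
  obtain ⟨n, ⟨i⟩⟩ := hf
  exact h n i

lemma anodyne_iff {A B : SSet.{0}} (i : A ⟶ B) :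
    Anodyne i ↔ anodyneExtensions i :=
  ⟨fun h _ _ p hp ↦ h p ((kanFibration_iff p).2 hp),
    fun h _ _ p hp ↦ h p ((kanFibration_iff p).1 hp)⟩

lemma anodyne_horn_ι (n : ℕ) (i : Fin (n + 2)) : Anodyne (SSet.horn (n + 1) i).ι :=
  fun _ _ _ hp ↦ hp n i

/-- The pushout product `pushoutProd i j`, as a Leibniz pushout. -/
noncomputable def pushoutObjObj {A B C D : SSet.{0}} (i : A ⟶ B) (j : C ⟶ D) :
    (curriedTensor SSet.{0}).PushoutObjObj i j where
  pt := pushout (A ◁ j) (i ▷ C)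
  inl := pushout.inr _ _
  inr := pushout.inl _ _
  isPushout := (IsPushout.of_hasPushout (A ◁ j) (i ▷ C)).flip
  ι := pushoutProd i j
  inl_ι := pushout.inr_desc _ _ _
  inr_ι := pushout.inl_desc _ _ _

/-- The pullback exponential `pullbackExp i p`, as a Leibniz pullback. -/
noncomputable def pullbackObjObj {A B X Y : SSet.{0}} (i : A ⟶ B) (p : X ⟶ Y) :
    (MonoidalClosed.internalHom (C := SSet.{0})).PullbackObjObj i p where
  pt := pullback ((ihom A).map p) ((MonoidalClosed.pre i).app Y)
  fst := pullback.fst _ _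
  snd := pullback.snd _ _
  isPullback := IsPullback.of_hasPullback _ _
  π := pullbackExp i p
  π_fst := pullback.lift_fst _ _ _
  π_snd := pullback.lift_snd _ _ _

lemma hasLiftingProperty_pushoutProd_iff {A B C D X Y : SSet.{0}}
    (i : A ⟶ B) (j : C ⟶ D) (p : X ⟶ Y) :
    HasLiftingProperty (pushoutProd i j) p ↔ HasLiftingProperty j (pullbackExp i p) :=
  MonoidalClosed.internalHomAdjunction₂.hasLiftingProperty_iff
    (pushoutObjObj i j) (pullbackObjObj i p)

lemma Anodyne.pushoutProd_mono {A B C D : SSet.{0}} {i : A ⟶ B}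
    (hi : Anodyne i) (j : C ⟶ D) [Mono j] : Anodyne (pushoutProd i j) :=
  (anodyne_iff _).2
    (anodyneExtensions_pushoutObjObjι' (pushoutObjObj i j) ((anodyne_iff i).1 hi))

lemma Anodyne.mono_pushoutProd {A B C D : SSet.{0}} {j : C ⟶ D}
    (hj : Anodyne j) (i : A ⟶ B) [Mono i] : Anodyne (pushoutProd i j) :=
  (anodyne_iff _).2
    (anodyneExtensions_pushoutObjObjι (pushoutObjObj i j) ((anodyne_iff j).1 hj))

lemma KanFibration.pullbackExp_of_mono {A B X Y : SSet.{0}} {p : X ⟶ Y}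
    (hp : KanFibration p) (i : A ⟶ B) [Mono i] : KanFibration (pullbackExp i p) :=
  fun n k ↦ (hasLiftingProperty_pushoutProd_iff i _ p).1
    ((anodyne_horn_ι n k).mono_pushoutProd i p hp)

lemma Anodyne.trivialFibration_pullbackExp {A B X Y : SSet.{0}} {i : A ⟶ B}
    (hi : Anodyne i) {p : X ⟶ Y} (hp : KanFibration p) :
    TrivialFibration (pullbackExp i p) :=
  fun n ↦ (hasLiftingProperty_pushoutProd_iff i _ p).1
    (hi.pushoutProd_mono (SSet.boundary n).ι p hp)

lemma KanFibration.ihom_map {X Y : SSet.{0}} {p : X ⟶ Y} (hp : KanFibration p)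
    (A : SSet.{0}) : KanFibration ((ihom A).map p) := fun n k ↦ by
  rw [← (ihom.adjunction A).hasLiftingProperty_iff]
  exact (anodyne_iff _).2
    (((anodyne_iff _).1 (anodyne_horn_ι n k)).whiskerLeft A) p hp

lemma KanComplex.ihom {K : SSet.{0}} (hK : KanComplex K) (A : SSet.{0}) :
    KanComplex ((ihom A).obj K) := by
  have hpt : IsTerminal Δ[0] := stdSimplex.isTerminalObj₀
  have hpt' : IsTerminal ((CategoryTheory.ihom A).obj Δ[0]) := hpt.isTerminalObj _ _
  intro n k
  have := KanFibration.ihom_map hK A n k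
  exact (HasLiftingProperty.iff_of_arrow_iso_right _
    (Arrow.isoMk' _ _ (Iso.refl _) (hpt'.uniqueUpToIso hpt) (hpt.hom_ext _ _))).1 this

end Paper

/-- (1) The pushout product of an anodyne map and a monomorphism is
anodyne.  (2) The pullback exponential of a monomorphism and a Kan fibration is a Kan
fibration; in particular exponentials of Kan complexes are Kan complexes.  (3) The
pullback exponential of an anodyne map and a Kan fibration is a trivial fibration. -/
theorem pushoutProduct_anodyne_and_pullbackExp_fibration :
    (∀ {A B C D : SSet.{0}} (i : A ⟶ B) (j : C ⟶ D),
      Paper.Anodyne i → Mono j → Paper.Anodyne (Paper.pushoutProd i j)) ∧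
    ((∀ {A B X Y : SSet.{0}} (i : A ⟶ B) (p : X ⟶ Y),
      Mono i → Paper.KanFibration p → Paper.KanFibration (Paper.pullbackExp i p)) ∧
      (∀ A K : SSet.{0}, Paper.KanComplex K → Paper.KanComplex ((ihom A).obj K))) ∧
    (∀ {A B X Y : SSet.{0}} (i : A ⟶ B) (p : X ⟶ Y),
      Paper.Anodyne i → Paper.KanFibration p →
        Paper.TrivialFibration (Paper.pullbackExp i p)) :=
  ⟨fun _ j hi _ ↦ hi.pushoutProd_mono j,
    ⟨fun i _ _ hp ↦ hp.pullbackExp_of_mono i, fun A _ hK ↦ hK.ihom A⟩,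
    fun _ _ hi hp ↦ hi.trivialFibration_pullbackExp hp⟩
end

section
/- Let p : X → Y be a Kan fibration of simplicial sets. Then p is a trivial fibration if and only if p is shrinkable, i.e., there exist a section s : Y → X with p∘s = id_Y and a homotopy H : X × Δ[1] → X from s∘p to id_X such that p∘H equals the composite of the projection X × Δ[1] → X with p. -/
open CategoryTheory CategoryTheory.Limits Simplicial MonoidalCategory SSet

namespace Paper

open FunctorToTypes in
/-- The inclusion of both ends of a cylinder is a monomorphism. -/
lemma mono_desc_ept (X : SSet.{0}) :
    Mono (show (FunctorToTypes.coprod X X : SSet.{0}) ⟶ X ⊗ Δ[1] from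
      coprod.desc (ept X 0) (ept X 1)) := by
  have hne (m : SimplexCategoryᵒᵖ) :
      SSet.stdSimplex.const.{0} 1 0 m ≠ SSet.stdSimplex.const 1 1 m := fun h ↦ by
    have := DFunLike.congr_fun (congr_arg SSet.stdSimplex.asOrderHom h) 0
    exact absurd this (by simp [SSet.stdSimplex.asOrderHom, SSet.stdSimplex.const_down_toOrderHom])
  refine (NatTrans.mono_iff_mono_app _).2 fun m ↦ (CategoryTheory.mono_iff_injective _).2 ?_
  rintro (x | x) (y | y) h
  · exact congr_arg Sum.inl (congr_arg Prod.fst h)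
  · exact (hne m (congr_arg Prod.snd h)).elim
  · exact (hne m (congr_arg Prod.snd h).symm).elim
  · exact congr_arg Sum.inr (congr_arg Prod.fst h)

lemma TrivialFibration.hasLiftingProperty {X Y A B : SSet.{0}} {p : X ⟶ Y}
    (hp : TrivialFibration p) (i : A ⟶ B) [Mono i] : HasLiftingProperty i p := by
  have h : modelCategoryQuillen.I.rlp p := by
    rintro _ _ _ ⟨n⟩
    exact hp n
  rw [← rlp_monomorphisms] at h
  exact h _ (MorphismProperty.monomorphisms.infer_property i)

lemma KanFibration.hasLiftingProperty {X Y A B : SSet.{0}} {p : X ⟶ Y}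
    (hp : KanFibration p) {i : A ⟶ B} (hi : anodyneExtensions i) :
    HasLiftingProperty i p := by
  refine hi p fun _ _ _ h ↦ ?_
  simp only [modelCategoryQuillen.J, MorphismProperty.iSup_iff] at h
  obtain ⟨n, ⟨k⟩⟩ := h
  exact hp n k

/-- The horn `Λ[1, 0]` is the vertex `0` of `Δ[1]`. -/
lemma horn_one_zero_ι_eq {Z : SSet.{0}} :
    Z ◁ (SSet.horn.{0} 1 0).ι = CartesianMonoidalCategory.fst Z _ ≫ ept Z 0 := by
  refine CartesianMonoidalCategory.hom_ext _ _ rfl ?_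
  ext m ⟨z, x, hx⟩
  induction m using Opposite.rec with | _ m
  induction m using SimplexCategory.rec with | _ m
  rw [mem_horn_iff_notMem_range] at hx
  obtain ⟨j, hj, hx⟩ := hx
  obtain rfl := Fin.eq_one_of_ne_zero j hj
  apply SSet.stdSimplex.ext
  intro k
  exact of_not_not fun h ↦ hx ⟨k, Fin.eq_one_of_ne_zero (x k) h⟩

theorem TrivialFibration.exists_shrinking {X Y : SSet.{0}} {p : X ⟶ Y}
    (hp : TrivialFibration p) :
    ∃ s : Y ⟶ X, s ≫ p = 𝟙 Y ∧
      ∃ H : X ⊗ Δ[1] ⟶ X, ept X 0 ≫ H = p ≫ s ∧ ept X 1 ≫ H = 𝟙 X ∧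
        H ≫ p = CartesianMonoidalCategory.fst X Δ[1] ≫ p := by
  have := hp.hasLiftingProperty (initial.to Y)
  have sqs : CommSq (initial.to X) (initial.to Y) p (𝟙 Y) := ⟨initial.hom_ext _ _⟩
  refine ⟨sqs.lift, sqs.fac_right, ?_⟩
  generalize hs : sqs.lift = s
  have hsp : s ≫ p = 𝟙 Y := hs ▸ sqs.fac_right
  have := mono_desc_ept X
  have := hp.hasLiftingProperty (show (FunctorToTypes.coprod X X : SSet.{0}) ⟶ X ⊗ Δ[1] from
      FunctorToTypes.coprod.desc (ept X 0) (ept X 1))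
  have sq : CommSq (show (FunctorToTypes.coprod X X : SSet.{0}) ⟶ X from
      FunctorToTypes.coprod.desc (p ≫ s) (𝟙 X))
      (show (FunctorToTypes.coprod X X : SSet.{0}) ⟶ X ⊗ Δ[1] from
        FunctorToTypes.coprod.desc (ept X 0) (ept X 1)) p
      (CartesianMonoidalCategory.fst X Δ[1] ≫ p) := by
    constructor
    ext m (x | x)
    · exact ConcreteCategory.congr_hom (NatTrans.congr_app hsp m) (p.app m x)
    · rfl
  refine ⟨sq.lift, ?_, ?_, sq.fac_right⟩
  · exact congr_arg (fun f : (FunctorToTypes.coprod X X : SSet.{0}) ⟶ X ↦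
      (show X ⟶ (FunctorToTypes.coprod X X : SSet.{0}) from FunctorToTypes.coprod.inl) ≫ f)
      sq.fac_left
  · exact congr_arg (fun f : (FunctorToTypes.coprod X X : SSet.{0}) ⟶ X ↦
      (show X ⟶ (FunctorToTypes.coprod X X : SSet.{0}) from FunctorToTypes.coprod.inr) ≫ f)
      sq.fac_left

theorem KanFibration.trivialFibration_of_shrinking {X Y : SSet.{0}} {p : X ⟶ Y}
    (hp : KanFibration p) {s : Y ⟶ X} (hs : s ≫ p = 𝟙 Y) {H : X ⊗ Δ[1] ⟶ X}
    (h₀ : ept X 0 ≫ H = p ≫ s) (h₁ : ept X 1 ≫ H = 𝟙 X)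
    (hH : H ≫ p = CartesianMonoidalCategory.fst X Δ[1] ≫ p) :
    TrivialFibration p := by
  refine fun n ↦ ⟨fun {a b} sq ↦ ?_⟩
  let A := SSet.boundary.{0} n
  let B := SSet.horn.{0} 1 0
  have := hp.hasLiftingProperty
    (anodyneExtensions_unionProd_ι A B (anodyneExtensions.horn_ι 0))
  have po := Subcomplex.unionProd.isPushout A B
  have hept (k : Fin 2) : ept (A : SSet.{0}) k ≫ a ▷ Δ[1] = a ≫ ept X k := rfl
  have hcomm : A.ι ▷ (B : SSet.{0}) ≫
      CartesianMonoidalCategory.fst Δ[n] (B : SSet.{0}) ≫ b ≫ s =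
      (A : SSet.{0}) ◁ B.ι ≫ a ▷ Δ[1] ≫ H := by
    rw [horn_one_zero_ι_eq, Category.assoc, ← Category.assoc (ept _ 0), hept,
      Category.assoc, h₀, reassoc_of% sq.w]
    rfl
  have sq' : CommSq (po.desc _ _ hcomm) (A.unionProd B).ι p
      (CartesianMonoidalCategory.fst Δ[n] Δ[1] ≫ b) := by
    constructor
    apply po.hom_ext
    · rw [po.inl_desc_assoc, Subcomplex.unionProd.ι₁_ι_assoc, Category.assoc, Category.assoc,
        hs, Category.comp_id]
      rfl
    · rw [po.inr_desc_assoc, Subcomplex.unionProd.ι₂_ι_assoc, Category.assoc, hH]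
      change CartesianMonoidalCategory.fst (A : SSet.{0}) Δ[1] ≫ a ≫ p = _
      rw [sq.w]
      rfl
  refine ⟨⟨⟨ept _ 1 ≫ sq'.lift, ?_, ?_⟩⟩⟩
  · calc A.ι ≫ ept Δ[n] 1 ≫ sq'.lift
        = ept (A : SSet.{0}) 1 ≫ Subcomplex.unionProd.ι₂ A B ≫
          (A.unionProd B).ι ≫ sq'.lift := rfl
      _ = a := by
        rw [sq'.fac_left, po.inr_desc, reassoc_of% hept, h₁, Category.comp_id]
  · rw [Category.assoc, sq'.fac_right]
    rfl

end Paper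

/-- A Kan fibration is a trivial fibration iff it is shrinkable. -/
theorem trivialFibration_iff_shrinkable {X Y : SSet.{0}} (p : X ⟶ Y)
    (hp : Paper.KanFibration p) :
    Paper.TrivialFibration p ↔
      ∃ s : Y ⟶ X, s ≫ p = 𝟙 Y ∧
        ∃ H : X ⊗ Δ[1] ⟶ X,
          Paper.ept X 0 ≫ H = p ≫ s ∧ Paper.ept X 1 ≫ H = 𝟙 X ∧
            H ≫ p = CartesianMonoidalCategory.fst X Δ[1] ≫ p := by
  exact ⟨fun h ↦ h.exists_shrinking, fun ⟨_, hs, _, h₀, h₁, hH⟩ ↦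
    hp.trivialFibration_of_shrinking hs h₀ h₁ hH⟩
end

section
/- Let p : X → Y be a Kan fibration over a simplicial set of the form Y = Δ[1] × A. Then the restrictions of X over {0} × A and over {1} × A are fiberwise homotopy equivalent over A: there is a map X|_{{0}×A} → X|_{{1}×A} over A that is a fiberwise homotopy equivalence over A. -/
open CategoryTheory CategoryTheory.Limits Simplicial MonoidalCategory SSet

/-- The inclusion `A ⟶ Δ[1] ⊗ A` at the vertex `k`. -/
noncomputable def endpointIncl (A : SSet.{0}) (k : Fin 2) : A ⟶ Δ[1] ⊗ A :=
  CartesianMonoidalCategory.lift (Paper.cst A k) (𝟙 A)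

namespace Paper

open modelCategoryQuillen in
/-- Anodyne extensions lift against Kan fibrations. -/
lemma KanFibration.hasLiftingProperty_s15 {E B K L : SSet.{0}} {p : E ⟶ B} (hp : KanFibration p)
    {j : K ⟶ L} (hj : anodyneExtensions j) : HasLiftingProperty j p := by
  refine hj p ?_
  rw [fibrations_eq]
  intro _ _ i hi
  simp only [J, MorphismProperty.iSup_iff] at hi
  obtain ⟨n, ⟨i⟩⟩ := hi
  exact hp n i

open modelCategoryQuillen in
/-- The vertex inclusions `Δ[0] ⟶ Δ[1]` are anodyne extensions. -/
lemma anodyneExtensions_δ_one (k : Fin 2) :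
    anodyneExtensions (stdSimplex.{0}.δ k : Δ[0] ⟶ Δ[1]) := by
  intro E B p hp
  have : HomotopicalAlgebra.Fibration p := ⟨hp⟩
  refine ⟨fun {x b} sq ↦ ?_⟩
  have hx : horn.IsCompatible (i := k.rev) (fun (_ : Fin 2) _ ↦ x) := trivial
  obtain ⟨φ, hφ, hφ'⟩ := hx.exists_lift p b (fun j hj ↦ by
    obtain rfl : j = k := by revert hj; fin_cases j <;> fin_cases k <;> simp
    exact sq.w)
  exact ⟨⟨φ, hφ k (by fin_cases k <;> simp), hφ'⟩⟩

/-- The isomorphism `X ≅ X ⊗ Δ[0]`. -/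
@[simps]
noncomputable def tensorPtIso (X : SSet.{0}) : X ≅ X ⊗ Δ[0] where
  hom := CartesianMonoidalCategory.lift (𝟙 X) (toPt X)
  inv := CartesianMonoidalCategory.fst X Δ[0]
  hom_inv_id := by simp
  inv_hom_id := by
    ext : 1
    · simp
    · exact stdSimplex.isTerminalObj₀.hom_ext _ _

lemma toPt_comp_δ (X : SSet.{0}) (k : Fin 2) :
    toPt X ≫ stdSimplex.δ k.rev = cst X k := by
  ext m x
  apply stdSimplex.objEquiv.injective
  ext j
  fin_cases k <;> rfl

lemma tensorPtIso_hom_whiskerLeft_δ (X : SSet.{0}) (k : Fin 2) :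
    (tensorPtIso X).hom ≫ X ◁ stdSimplex.δ k.rev = ept X k := by
  simp [ept, toPt_comp_δ]

lemma anodyneExtensions_ept (X : SSet.{0}) (k : Fin 2) : anodyneExtensions (ept X k) := by
  rw [← tensorPtIso_hom_whiskerLeft_δ]
  exact MorphismProperty.comp_mem _ _ _ (.of_isIso _) ((anodyneExtensions_δ_one _).whiskerLeft X)

@[simp]
lemma ept_fst (X : SSet.{0}) (k : Fin 2) :
    ept X k ≫ CartesianMonoidalCategory.fst X Δ[1] = 𝟙 X := by
  simp [ept]

@[simp]
lemma ept_fst_assoc (X : SSet.{0}) (k : Fin 2) {Y : SSet.{0}} (f : X ⟶ Y) :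
    ept X k ≫ CartesianMonoidalCategory.fst X Δ[1] ≫ f = f := by
  rw [← Category.assoc, ept_fst, Category.id_comp]

@[simp]
lemma ept_snd (X : SSet.{0}) (k : Fin 2) :
    ept X k ≫ CartesianMonoidalCategory.snd X Δ[1] = cst X k := by
  simp [ept]

lemma comp_cst {X Y : SSet.{0}} (f : X ⟶ Y) (k : Fin 2) : f ≫ cst Y k = cst X k := rfl

lemma endpointIncl_fst (A : SSet.{0}) (k : Fin 2) :
    endpointIncl A k ≫ CartesianMonoidalCategory.fst Δ[1] A = cst A k := by
  simp [endpointIncl]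

lemma endpointIncl_snd (A : SSet.{0}) (k : Fin 2) :
    endpointIncl A k ≫ CartesianMonoidalCategory.snd Δ[1] A = 𝟙 A := by
  simp [endpointIncl]

lemma ept_naturality {X Y : SSet.{0}} (f : X ⟶ Y) (k : Fin 2) :
    ept X k ≫ f ▷ Δ[1] = f ≫ ept Y k := by
  ext : 1 <;> simp [comp_cst]

lemma ept_naturality_assoc {X Y : SSet.{0}} (f : X ⟶ Y) (k : Fin 2) {Z : SSet.{0}}
    (h : Y ⊗ Δ[1] ⟶ Z) : ept X k ≫ f ▷ Δ[1] ≫ h = f ≫ ept Y k ≫ h := by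
  rw [← Category.assoc, ept_naturality, Category.assoc]

lemma whiskerLeft_comp_δ (Z : SSet.{0}) {K : SSet.{0}} (τ : K ⟶ Δ[0]) (k : Fin 2) :
    Z ◁ (τ ≫ stdSimplex.δ k.rev) = CartesianMonoidalCategory.fst Z K ≫ ept Z k := by
  have h : Z ◁ τ = CartesianMonoidalCategory.fst Z K ≫ (tensorPtIso Z).hom := by
    ext : 1
    · simp
    · exact stdSimplex.isTerminalObj₀.hom_ext _ _
  rw [whiskerLeft_comp, h, Category.assoc, tensorPtIso_hom_whiskerLeft_δ]

/-- If `M` is the gluing of two intervals along the vertex `l` and `M ⟶ N` is an anodyne extension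
such that `N` retracts onto each of these intervals, then any edge `d` of `N` joining their other
endpoints gives a homotopy between the restrictions to these endpoints of homotopies `a` and `b`
that agree at `l`. -/
lemma exists_homotopy_of_isPushout {E B Z M N : SSet.{0}} {p : E ⟶ B} (hp : KanFibration p)
    {k l k' l' : Fin 2} (hk : k' = k.rev) (hl : l' = l.rev) {i₁ i₂ : Δ[1] ⟶ M}
    (h : IsPushout (stdSimplex.δ l') (stdSimplex.δ l') i₁ i₂)
    {j : M ⟶ N} (hj : anodyneExtensions j)
    {s t d : Δ[1] ⟶ N} (hs : i₁ ≫ j = s) (ht : i₂ ≫ j = t)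
    {r : N ⟶ Δ[1]} (hsr : s ≫ r = 𝟙 _) (htr : t ≫ r = 𝟙 _)
    {τ : Δ[1] ⟶ Δ[0]} (hdr : d ≫ r = τ ≫ stdSimplex.δ k')
    (hds : stdSimplex.δ 1 ≫ d = stdSimplex.δ k' ≫ s)
    (hdt : stdSimplex.δ 0 ≫ d = stdSimplex.δ k' ≫ t)
    {a b : Z ⊗ Δ[1] ⟶ E} (hab : ept Z l ≫ a = ept Z l ≫ b) (hp_ab : a ≫ p = b ≫ p) :
    ∃ H : Z ⊗ Δ[1] ⟶ E, ept Z 0 ≫ H = ept Z k ≫ a ∧ ept Z 1 ≫ H = ept Z k ≫ b ∧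
      H ≫ p = CartesianMonoidalCategory.fst Z Δ[1] ≫ ept Z k ≫ a ≫ p := by
  subst hk hl
  have h₀ : ept Z 0 = (tensorPtIso Z).hom ≫ Z ◁ stdSimplex.δ 1 :=
    (tensorPtIso_hom_whiskerLeft_δ Z 0).symm
  have h₁ : ept Z 1 = (tensorPtIso Z).hom ≫ Z ◁ stdSimplex.δ 0 :=
    (tensorPtIso_hom_whiskerLeft_δ Z 1).symm
  have hZ : IsPushout (Z ◁ stdSimplex.δ l.rev) (Z ◁ stdSimplex.δ l.rev) (Z ◁ i₁) (Z ◁ i₂) :=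
    h.map (tensorLeft Z)
  have hab' : Z ◁ stdSimplex.δ l.rev ≫ a = Z ◁ stdSimplex.δ l.rev ≫ b := by
    simpa only [← tensorPtIso_hom_whiskerLeft_δ, Category.assoc, cancel_epi] using hab
  have := hp.hasLiftingProperty_s15 (hj.whiskerLeft Z)
  have sq : CommSq (hZ.desc a b hab') (Z ◁ j) p (Z ◁ r ≫ a ≫ p) := ⟨hZ.hom_ext
    (by rw [hZ.inl_desc_assoc, ← whiskerLeft_comp_assoc, ← whiskerLeft_comp_assoc, hs, hsr,
      whiskerLeft_id, Category.id_comp])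
    (by rw [hZ.inr_desc_assoc, ← whiskerLeft_comp_assoc, ← whiskerLeft_comp_assoc, ht, htr,
      whiskerLeft_id, Category.id_comp, hp_ab])⟩
  have hΦs : Z ◁ s ≫ sq.lift = a := by
    rw [← hs, whiskerLeft_comp_assoc, sq.fac_left, hZ.inl_desc]
  have hΦt : Z ◁ t ≫ sq.lift = b := by
    rw [← ht, whiskerLeft_comp_assoc, sq.fac_left, hZ.inr_desc]
  refine ⟨Z ◁ d ≫ sq.lift, ?_, ?_, ?_⟩
  · rw [h₀, Category.assoc, ← whiskerLeft_comp_assoc, hds,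
      whiskerLeft_comp_assoc, hΦs, ← Category.assoc, tensorPtIso_hom_whiskerLeft_δ]
  · rw [h₁, Category.assoc, ← whiskerLeft_comp_assoc, hdt,
      whiskerLeft_comp_assoc, hΦt, ← Category.assoc, tensorPtIso_hom_whiskerLeft_δ]
  · rw [Category.assoc, sq.fac_right, ← whiskerLeft_comp_assoc, hdr, whiskerLeft_comp_δ, Category.assoc]

/-- Two homotopies with the same image under a Kan fibration that agree at one end are
fiberwise homotopic at the other end. -/
lemma exists_homotopy_of_ept_eq {E B Z : SSet.{0}} {p : E ⟶ B} (hp : KanFibration p)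
    {k l : Fin 2} (hkl : k ≠ l) {a b : Z ⊗ Δ[1] ⟶ E} (hab : ept Z l ≫ a = ept Z l ≫ b)
    (hp_ab : a ≫ p = b ≫ p) :
    ∃ H : Z ⊗ Δ[1] ⟶ E, ept Z 0 ≫ H = ept Z k ≫ a ∧ ept Z 1 ≫ H = ept Z k ≫ b ∧
      H ≫ p = CartesianMonoidalCategory.fst Z Δ[1] ≫ ept Z k ≫ a ≫ p := by
  obtain ⟨rfl, rfl⟩ | ⟨rfl, rfl⟩ : k = 0 ∧ l = 1 ∨ k = 1 ∧ l = 0 := by lia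
  · have hs : stdSimplex.{0}.δ (1 : Fin 3) ≫ stdSimplex.σ (0 : Fin 2) = 𝟙 _ :=
      CosimplicialObject.δ_comp_σ_succ _ (i := 0)
    have ht : stdSimplex.{0}.δ (0 : Fin 3) ≫ stdSimplex.σ (0 : Fin 2) = 𝟙 _ :=
      CosimplicialObject.δ_comp_σ_self _ (i := 0)
    have hdr : stdSimplex.{0}.δ (2 : Fin 3) ≫ stdSimplex.σ (0 : Fin 2) =
        stdSimplex.σ (0 : Fin 1) ≫ stdSimplex.δ (1 : Fin 2) :=
      CosimplicialObject.δ_comp_σ_of_gt _ (i := 1) (j := 0) (by decide)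
    have hds : stdSimplex.{0}.δ (1 : Fin 2) ≫ stdSimplex.δ (2 : Fin 3) =
        stdSimplex.δ (1 : Fin 2) ≫ stdSimplex.δ (1 : Fin 3) :=
      CosimplicialObject.δ_comp_δ _ (i := 1) (j := 1) le_rfl
    have hdt : stdSimplex.{0}.δ (0 : Fin 2) ≫ stdSimplex.δ (2 : Fin 3) =
        stdSimplex.δ (1 : Fin 2) ≫ stdSimplex.δ (0 : Fin 3) :=
      CosimplicialObject.δ_comp_δ _ (i := 0) (j := 1) (by decide)
    exact exists_homotopy_of_isPushout hp (k' := 1) (l' := 0) rfl rfl horn₂₂.isPushout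
      (anodyneExtensions.horn_ι (n := 2) 2) (horn.ι_ι _ _ _) (horn.ι_ι _ _ _) hs ht hdr hds hdt
      hab hp_ab
  · have hs : stdSimplex.{0}.δ (2 : Fin 3) ≫ stdSimplex.σ (1 : Fin 2) = 𝟙 _ :=
      CosimplicialObject.δ_comp_σ_succ _ (i := 1)
    have ht : stdSimplex.{0}.δ (1 : Fin 3) ≫ stdSimplex.σ (1 : Fin 2) = 𝟙 _ :=
      CosimplicialObject.δ_comp_σ_self _ (i := 1)
    have hdr : stdSimplex.{0}.δ (0 : Fin 3) ≫ stdSimplex.σ (1 : Fin 2) =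
        stdSimplex.σ (0 : Fin 1) ≫ stdSimplex.δ (0 : Fin 2) :=
      CosimplicialObject.δ_comp_σ_of_le _ (i := 0) (j := 0) le_rfl
    have hds : stdSimplex.{0}.δ (1 : Fin 2) ≫ stdSimplex.δ (0 : Fin 3) =
        stdSimplex.δ (0 : Fin 2) ≫ stdSimplex.δ (2 : Fin 3) :=
      (CosimplicialObject.δ_comp_δ _ (i := 0) (j := 1) (by decide)).symm
    have hdt : stdSimplex.{0}.δ (0 : Fin 2) ≫ stdSimplex.δ (0 : Fin 3) =
        stdSimplex.δ (0 : Fin 2) ≫ stdSimplex.δ (1 : Fin 3) :=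
      (CosimplicialObject.δ_comp_δ _ (i := 0) (j := 0) le_rfl).symm
    exact exists_homotopy_of_isPushout hp (k' := 0) (l' := 1) rfl rfl horn₂₀.isPushout
      (anodyneExtensions.horn_ι (n := 2) 0) (horn.ι_ι _ _ _) (horn.ι_ι _ _ _) hs ht hdr hds hdt
      hab hp_ab

/-- Maps over `Δ[1] ⊗ A` out of the restriction over `{k} × A` extend along the interval. -/
lemma exists_transport {A X : SSet.{0}} {p : X ⟶ Δ[1] ⊗ A} (hp : KanFibration p) (k : Fin 2) :
    ∃ T : pullback (endpointIncl A k) p ⊗ Δ[1] ⟶ X,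
      ept _ k ≫ T = pullback.snd (endpointIncl A k) p ∧
      T ≫ p = CartesianMonoidalCategory.lift (CartesianMonoidalCategory.snd _ _)
        (CartesianMonoidalCategory.fst _ _ ≫ pullback.fst (endpointIncl A k) p) := by
  have := hp.hasLiftingProperty_s15 (anodyneExtensions_ept (pullback (endpointIncl A k) p) k)
  have sq : CommSq (pullback.snd (endpointIncl A k) p) (ept _ k) p
      (CartesianMonoidalCategory.lift (CartesianMonoidalCategory.snd _ _)
        (CartesianMonoidalCategory.fst _ _ ≫ pullback.fst (endpointIncl A k) p)) := ⟨by
    rw [← pullback.condition]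
    ext : 1 <;> simp [endpointIncl, comp_cst]⟩
  exact ⟨sq.lift, by simp, by simp⟩

/-- Transporting along the interval and back is fiberwise homotopic to the identity. -/
lemma fibHomotopic_transport {A X : SSet.{0}} {p : X ⟶ Δ[1] ⊗ A} (hp : KanFibration p)
    {k l : Fin 2} (hkl : k ≠ l)
    {T : pullback (endpointIncl A k) p ⊗ Δ[1] ⟶ X}
    (hT : ept _ k ≫ T = pullback.snd (endpointIncl A k) p)
    (hTp : T ≫ p = CartesianMonoidalCategory.lift (CartesianMonoidalCategory.snd _ _)
        (CartesianMonoidalCategory.fst _ _ ≫ pullback.fst (endpointIncl A k) p))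
    {T' : pullback (endpointIncl A l) p ⊗ Δ[1] ⟶ X}
    (hT' : ept _ l ≫ T' = pullback.snd (endpointIncl A l) p)
    (hTp' : T' ≫ p = CartesianMonoidalCategory.lift (CartesianMonoidalCategory.snd _ _)
        (CartesianMonoidalCategory.fst _ _ ≫ pullback.fst (endpointIncl A l) p))
    {f : pullback (endpointIncl A k) p ⟶ pullback (endpointIncl A l) p}
    (hf : f ≫ pullback.fst _ _ = pullback.fst _ _) (hf' : f ≫ pullback.snd _ _ = ept _ l ≫ T)
    {g : pullback (endpointIncl A l) p ⟶ pullback (endpointIncl A k) p}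
    (hg : g ≫ pullback.fst _ _ = pullback.fst _ _) (hg' : g ≫ pullback.snd _ _ = ept _ k ≫ T') :
    FibHomotopic (pullback.fst (endpointIncl A k) p) (pullback.fst (endpointIncl A k) p)
      (f ≫ g) (𝟙 _) := by
  obtain ⟨H, h₀, h₁, hH⟩ := exists_homotopy_of_ept_eq hp hkl (a := f ▷ Δ[1] ≫ T') (b := T)
    (by rw [ept_naturality_assoc, hT', hf'])
    (by
      rw [Category.assoc, hTp, hTp']
      ext : 1 <;> simp [hf])
  have hw : (CartesianMonoidalCategory.fst _ Δ[1] ≫ pullback.fst (endpointIncl A k) p) ≫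
      endpointIncl A k = H ≫ p := by
    rw [hH, Category.assoc, Category.assoc, ept_naturality_assoc, hTp']
    congr 1
    ext : 1 <;> simp [endpointIncl_fst, endpointIncl_snd, comp_cst, hf]
  have h₀' : ept _ 0 ≫ pullback.lift _ H hw = f ≫ g := by
    apply pullback.hom_ext
    · rw [Category.assoc, pullback.lift_fst, ept_fst_assoc, Category.assoc, hg, hf]
    · rw [Category.assoc, pullback.lift_snd, h₀, ept_naturality_assoc, Category.assoc, hg']
  have h₁' : ept _ 1 ≫ pullback.lift _ H hw = 𝟙 _ := by
    apply pullback.hom_ext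
    · rw [Category.assoc, pullback.lift_fst, ept_fst_assoc, Category.id_comp]
    · rw [Category.assoc, pullback.lift_snd, h₁, hT, Category.id_comp]
  exact .rel _ _ ⟨_, h₀', h₁', pullback.lift_fst _ _ _⟩

end Paper

/-- For a Kan fibration over `Δ[1] ⊗ A`, the restrictions over the two
endpoints are fiberwise homotopy equivalent over `A`. -/
theorem fiber_transport {A X : SSet.{0}} (p : X ⟶ Δ[1] ⊗ A) (hp : Paper.KanFibration p) :
    ∃ f : pullback (endpointIncl A 0) p ⟶ pullback (endpointIncl A 1) p,
      Paper.FibHomotopyEquivalence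
        (pullback.fst (endpointIncl A 0) p) (pullback.fst (endpointIncl A 1) p) f := by
  obtain ⟨T, hT, hTp⟩ := Paper.exists_transport hp 0
  obtain ⟨T', hT', hTp'⟩ := Paper.exists_transport hp 1
  let f : pullback (endpointIncl A 0) p ⟶ pullback (endpointIncl A 1) p :=
    pullback.lift (pullback.fst _ _) (Paper.ept _ 1 ≫ T) (by
      rw [Category.assoc, hTp]
      ext : 1 <;> simp [endpointIncl, Paper.comp_cst])
  let g : pullback (endpointIncl A 1) p ⟶ pullback (endpointIncl A 0) p :=
    pullback.lift (pullback.fst _ _) (Paper.ept _ 0 ≫ T') (by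
      rw [Category.assoc, hTp']
      ext : 1 <;> simp [endpointIncl, Paper.comp_cst])
  have hf : f ≫ pullback.fst _ _ = pullback.fst _ _ := pullback.lift_fst _ _ _
  have hf' : f ≫ pullback.snd _ _ = Paper.ept _ 1 ≫ T := pullback.lift_snd _ _ _
  have hg : g ≫ pullback.fst _ _ = pullback.fst _ _ := pullback.lift_fst _ _ _
  have hg' : g ≫ pullback.snd _ _ = Paper.ept _ 0 ≫ T' := pullback.lift_snd _ _ _
  exact ⟨f, hf, g, hg,
    Paper.fibHomotopic_transport hp (by decide) hT hTp hT' hTp' hf hf' hg hg',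
    Paper.fibHomotopic_transport hp (by decide) hT' hTp' hT hTp hg hg' hf hf'⟩
end
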